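/- arXiv:1911.10163 — 2 statements merged into one kernel-verified Lean document; each statement's English description precedes it below -/
import Mathlib

section
/- (Lemma 1) Let M be a complex-valued continuous kernel on the triangle {(x,t) : 0 ≤ t ≤ x ≤ π}, and for each λ ∈ ℂ let e(·,λ) be the solution of equation (1) with e(0,λ) = 1. Then there exists a continuous function G on the triangle {(x,t) : 0 ≤ t ≤ x ≤ π}, independent of λ, such that e(x,λ) = exp(−iλx) + ∫₀ˣ G(x,t)·exp(−iλt) dt for all x ∈ [0,π] and all λ ∈ ℂ; moreover G(x,0) = 0 and G(x,x) = i·∫₀ˣ M(t,t) dt for all x ∈ [0,π]. -/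
open Complex MeasureTheory Set Real

/-- The triangle `{(x,t) : 0 ≤ t ≤ x ≤ π}`. -/
def Triangle : Set (ℝ × ℝ) := {p | 0 ≤ p.2 ∧ p.2 ≤ p.1 ∧ p.1 ≤ Real.pi}

open scoped BoundedContinuousFunction

/-- A continuous function on the triangle extends to a bounded continuous function on the plane. -/
lemma exists_bounded_continuous_extension (M : ℝ → ℝ → ℂ)
    (hM : ContinuousOn (fun p : ℝ × ℝ => M p.1 p.2) Triangle) :
    ∃ N : ℝ → ℝ → ℂ, Continuous (fun p : ℝ × ℝ => N p.1 p.2) ∧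
      (∃ C : ℝ, 0 ≤ C ∧ ∀ x t, ‖N x t‖ ≤ C) ∧
      ∀ x t, 0 ≤ t → t ≤ x → x ≤ Real.pi → N x t = M x t := by
  let a : ℝ → ℝ := fun x => max 0 (min x Real.pi)
  let b : ℝ → ℝ → ℝ := fun x t => max 0 (min t (a x))
  have hmem : ∀ x t, (a x, b x t) ∈ Triangle := fun x t =>
    ⟨le_max_left _ _, max_le (le_max_left _ _) (min_le_right _ _),
      max_le Real.pi_pos.le (min_le_right _ _)⟩
  have hcompact : IsCompact Triangle := by
    refine ((isCompact_Icc (a := (0:ℝ)) (b := Real.pi)).prod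
      (isCompact_Icc (a := (0:ℝ)) (b := Real.pi))).of_isClosed_subset ?_ ?_
    · exact (isClosed_le continuous_const continuous_snd).inter
        ((isClosed_le continuous_snd continuous_fst).inter
          (isClosed_le continuous_fst continuous_const))
    · rintro ⟨x, t⟩ ⟨h₀, h₁, h₂⟩
      exact ⟨⟨h₀.trans h₁, h₂⟩, ⟨h₀, h₁.trans h₂⟩⟩
  obtain ⟨C, hC⟩ := hcompact.exists_bound_of_continuousOn hM
  refine ⟨fun x t => M (a x) (b x t), ?_, ⟨C, ?_, fun x t => hC _ (hmem x t)⟩, ?_⟩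
  · exact hM.comp_continuous (f := fun p : ℝ × ℝ => (a p.1, b p.1 p.2)) (by fun_prop)
      fun p => hmem p.1 p.2
  · exact (norm_nonneg _).trans (hC _ (hmem 0 0))
  · intro x t h₀ h₁ h₂
    have ha : a x = x := by simp [a, h₂, h₀.trans h₁]
    have hb : b x t = t := by simp [b, ha, h₁, h₀]
    simp only [ha, hb]

/-- Continuity of an integral with continuous parameters and continuous upper limit. -/
lemma continuous_integral_of_continuous {X : Type*} [TopologicalSpace X]
    [FirstCountableTopology X] {f : X → ℝ → ℂ} (hf : Continuous fun p : X × ℝ => f p.1 p.2)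
    {s : X → ℝ} (hs : Continuous s) : Continuous fun x => ∫ t in (0:ℝ)..s x, f x t :=
  intervalIntegral.continuous_parametric_intervalIntegral_of_continuous hf hs

/-- Interchange of the order of integration over the triangle `d, v ≥ 0`, `d + v ≤ x`. -/
lemma integral_triangle_swap {g : ℝ → ℝ → ℂ} (hg : Continuous fun p : ℝ × ℝ => g p.1 p.2)
    {x : ℝ} (hx : 0 ≤ x) :
    ∫ d in (0:ℝ)..x, ∫ v in (0:ℝ)..(x - d), g d v =
      ∫ s in (0:ℝ)..x, ∫ d in (0:ℝ)..s, g d (s - d) := by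
  let S : Set (ℝ × ℝ) := {p | p.1 < p.2}
  have hS : MeasurableSet S := measurableSet_lt measurable_fst measurable_snd
  let F : ℝ → ℝ → ℂ := fun d s => S.indicator (fun p : ℝ × ℝ => g p.1 (p.2 - p.1)) (d, s)
  have hcont : Continuous fun p : ℝ × ℝ => g p.1 (p.2 - p.1) :=
    hg.comp (f := fun p : ℝ × ℝ => (p.1, p.2 - p.1)) (by fun_prop)
  have hswap : ∫ d in (0:ℝ)..x, ∫ s in (0:ℝ)..x, F d s =
      ∫ s in (0:ℝ)..x, ∫ d in (0:ℝ)..x, F d s := by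
    apply intervalIntegral_intervalIntegral_swap
    have h : IntegrableOn (fun p : ℝ × ℝ => g p.1 (p.2 - p.1)) (uIcc 0 x ×ˢ uIcc 0 x) :=
      hcont.continuousOn.integrableOn_compact (isCompact_uIcc.prod isCompact_uIcc)
    exact (h.mono_set (prod_mono uIoc_subset_uIcc uIoc_subset_uIcc)).indicator hS
  have hleft : ∀ d ∈ uIcc 0 x, ∫ v in (0:ℝ)..(x - d), g d v = ∫ s in (0:ℝ)..x, F d s := by
    intro d hd
    rw [uIcc_of_le hx] at hd
    have h₁ : ∫ v in (0:ℝ)..(x - d), g d v = ∫ s in d..x, g d (s - d) := by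
      rw [intervalIntegral.integral_comp_sub_right (fun v => g d v) d, sub_self]
    rw [h₁, intervalIntegral.integral_of_le hd.2, intervalIntegral.integral_of_le hx]
    have h₂ : (fun s => F d s) = (Ioi d).indicator fun s => g d (s - d) := by
      ext s
      simp [F, S, indicator]
    rw [h₂, setIntegral_indicator measurableSet_Ioi]
    congr 2
    ext s
    simp only [mem_Ioc, mem_inter_iff, mem_Ioi]
    exact ⟨fun h => ⟨⟨hd.1.trans_lt h.1, h.2⟩, h.1⟩, fun h => ⟨h.2, h.1.2⟩⟩
  have hright : ∀ s ∈ uIcc 0 x, ∫ d in (0:ℝ)..s, g d (s - d) = ∫ d in (0:ℝ)..x, F d s := by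
    intro s hs
    rw [uIcc_of_le hx] at hs
    rw [intervalIntegral.integral_of_le hs.1, intervalIntegral.integral_of_le hx]
    have h₂ : (fun d => F d s) = (Iio s).indicator fun d => g d (s - d) := by
      ext d
      simp [F, S, indicator]
    rw [h₂, setIntegral_indicator measurableSet_Iio, integral_Ioc_eq_integral_Ioo]
    congr 2
    ext d
    simp only [mem_Ioc, mem_Ioo, mem_inter_iff, mem_Iio]
    exact ⟨fun h => ⟨⟨h.1, h.2.le.trans hs.2⟩, h.2⟩, fun h => ⟨h.1.1, h.2⟩⟩
  rw [intervalIntegral.integral_congr hleft, hswap, intervalIntegral.integral_congr hright]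

/-- A continuous function dominated by a multiple of the integral of its norm vanishes. -/
lemma eq_zero_of_norm_le_mul_integral_norm {f : ℝ → ℂ} (hf : Continuous f) {K L : ℝ}
    (h : ∀ x ∈ Icc 0 L, ‖f x‖ ≤ K * ∫ t in (0:ℝ)..x, ‖f t‖) : ∀ x ∈ Icc 0 L, f x = 0 := by
  have hderiv : ∀ x, HasDerivAt (fun x => ∫ t in (0:ℝ)..x, ‖f t‖) ‖f x‖ x := fun x =>
    hf.norm.integral_hasStrictDerivAt 0 x |>.hasDerivAt
  have hzero := eq_zero_of_abs_deriv_le_mul_abs_self_of_eq_zero_right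
    (f := fun x => ∫ t in (0:ℝ)..x, ‖f t‖) (f' := fun x => ‖f x‖) (K := K) (a := 0) (b := L)
    (fun x _ => (hderiv x).continuousAt.continuousWithinAt)
    (fun x _ => (hderiv x).hasDerivWithinAt) (by simp) (by
      intro x hx
      have h₀ : 0 ≤ ∫ t in (0:ℝ)..x, ‖f t‖ :=
        intervalIntegral.integral_nonneg hx.1 fun _ _ => norm_nonneg _
      rw [norm_norm, Real.norm_of_nonneg h₀]
      exact h x ⟨hx.1, hx.2.le⟩)
  intro x hx
  have hx' := h x hx
  rw [hzero x hx, mul_zero] at hx'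
  exact norm_le_zero_iff.1 hx'

/-- Solvability of the Goursat-type integral equation satisfied, in the coordinates `d = x - t` and
`u = t`, by the kernel of the transformation operator. -/
lemma exists_goursat_solution {N : ℝ → ℝ → ℂ} (hN : Continuous fun p : ℝ × ℝ => N p.1 p.2)
    {C : ℝ} (hC : 0 ≤ C) (hNC : ∀ x t, ‖N x t‖ ≤ C) {L : ℝ} (hL : 0 ≤ L) :
    ∃ Φ : ℝ → ℝ → ℂ, Continuous (fun p : ℝ × ℝ => Φ p.1 p.2) ∧
      ∀ d ∈ Icc 0 L, ∀ u ∈ Icc 0 L, Φ d u =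
        I * ∫ v in (0:ℝ)..u, (N (d + v) v + ∫ r in (0:ℝ)..d, N (d + v) (v + r) * Φ r v) := by
  let k : ℝ := 2 * (C * L) + 1
  have hCL : 0 ≤ C * L := mul_nonneg hC hL
  have hk : 0 < k := by positivity
  let c : ℝ → ℝ := fun x => max 0 (min x L)
  have hc : Continuous c := by fun_prop
  have hc_mem : ∀ x, c x ∈ Icc 0 L := fun x => ⟨le_max_left _ _, max_le hL (min_le_right _ _)⟩
  have hc_eq : ∀ x ∈ Icc 0 L, c x = x := fun x hx => by simp [c, hx.1, hx.2]
  let inner : (ℝ → ℝ → ℂ) → ℝ → ℝ → ℂ := fun Ψ d v =>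
    ∫ r in (0:ℝ)..d, N (d + v) (v + r) * ((Real.exp (k * v) : ℂ) * Ψ r v)
  let op : (ℝ → ℝ → ℂ) → ℝ → ℝ → ℂ := fun Ψ d u =>
    (Real.exp (-(k * u)) : ℂ) * (I * ∫ v in (0:ℝ)..u, (N (d + v) v + inner Ψ d v))
  have hN₁ : Continuous fun p : ℝ × ℝ => N (p.1 + p.2) p.2 :=
    hN.comp (f := fun p : ℝ × ℝ => (p.1 + p.2, p.2)) (by fun_prop)
  have hinner : ∀ Ψ : ℝ → ℝ → ℂ, Continuous (fun p : ℝ × ℝ => Ψ p.1 p.2) →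
      Continuous fun p : ℝ × ℝ => inner Ψ p.1 p.2 := by
    intro Ψ hΨ
    refine continuous_integral_of_continuous (X := ℝ × ℝ) (s := fun p => p.1)
      (f := fun p r => N (p.1 + p.2) (p.2 + r) * ((Real.exp (k * p.2) : ℂ) * Ψ r p.2)) ?_
      continuous_fst
    refine (hN.comp (f := fun q : (ℝ × ℝ) × ℝ => (q.1.1 + q.1.2, q.1.2 + q.2))
      (by fun_prop)).mul (Continuous.mul (by fun_prop) ?_)
    exact hΨ.comp (f := fun q : (ℝ × ℝ) × ℝ => (q.2, q.1.2)) (by fun_prop)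
  have hop : ∀ Ψ : ℝ → ℝ → ℂ, Continuous (fun p : ℝ × ℝ => Ψ p.1 p.2) →
      Continuous fun p : ℝ × ℝ => op Ψ p.1 p.2 := by
    intro Ψ hΨ
    refine Continuous.mul (by fun_prop) (continuous_const.mul ?_)
    refine continuous_integral_of_continuous (X := ℝ × ℝ) (s := fun p => p.2)
      (f := fun p v => N (p.1 + v) v + inner Ψ p.1 v) ?_ continuous_snd
    exact (hN₁.add (hinner Ψ hΨ)).comp (f := fun q : (ℝ × ℝ) × ℝ => (q.1.1, q.2)) (by fun_prop)
  have hbound : ∀ Ψ : ℝ × ℝ →ᵇ ℂ, ∃ B, ∀ p : ℝ × ℝ,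
      ‖op (fun r v => Ψ (r, v)) (c p.1) (c p.2)‖ ≤ B := by
    intro Ψ
    obtain ⟨B, hB⟩ := ((isCompact_Icc (a := (0:ℝ)) (b := L)).prod
      (isCompact_Icc (a := (0:ℝ)) (b := L))).exists_bound_of_continuousOn
      (hop (fun r v => Ψ (r, v)) Ψ.continuous).continuousOn
    exact ⟨B, fun p => hB (c p.1, c p.2) ⟨hc_mem _, hc_mem _⟩⟩
  choose B hB using hbound
  let T : (ℝ × ℝ →ᵇ ℂ) → (ℝ × ℝ →ᵇ ℂ) := fun Ψ =>
    BoundedContinuousFunction.ofNormedAddCommGroup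
      (fun p : ℝ × ℝ => op (fun r v => Ψ (r, v)) (c p.1) (c p.2))
      ((hop (fun r v => Ψ (r, v)) Ψ.continuous).comp
        (f := fun p : ℝ × ℝ => (c p.1, c p.2)) (by fun_prop)) (B Ψ) (hB Ψ)
  have hlip : ∀ Ψ₁ Ψ₂ : ℝ × ℝ →ᵇ ℂ, ∀ d ∈ Icc 0 L, ∀ u ∈ Icc 0 L,
      ‖op (fun r v => Ψ₁ (r, v)) d u - op (fun r v => Ψ₂ (r, v)) d u‖ ≤
        1 / 2 * dist Ψ₁ Ψ₂ := by
    intro Ψ₁ Ψ₂ d hd u hu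
    have hi : ∀ Ψ : ℝ × ℝ →ᵇ ℂ, Continuous fun v => inner (fun r v => Ψ (r, v)) d v := fun Ψ =>
      (hinner (fun r v => Ψ (r, v)) Ψ.continuous).comp (f := fun v : ℝ => (d, v)) (by fun_prop)
    have hm : Continuous fun v => N (d + v) v :=
      hN₁.comp (f := fun v : ℝ => (d, v)) (by fun_prop)
    have hii : ∀ (Ψ : ℝ × ℝ →ᵇ ℂ) (v : ℝ), Continuous fun r =>
        N (d + v) (v + r) * ((Real.exp (k * v) : ℂ) * Ψ (r, v)) := fun Ψ v =>
      (hN.comp (f := fun r : ℝ => (d + v, v + r)) (by fun_prop)).mul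
        (continuous_const.mul (Ψ.continuous.comp (by fun_prop)))
    have hinner_le : ∀ v, ‖inner (fun r v => Ψ₁ (r, v)) d v - inner (fun r v => Ψ₂ (r, v)) d v‖ ≤
        C * L * dist Ψ₁ Ψ₂ * Real.exp (k * v) := by
      intro v
      have h₁ : ‖inner (fun r v => Ψ₁ (r, v)) d v - inner (fun r v => Ψ₂ (r, v)) d v‖ ≤
          C * (Real.exp (k * v) * dist Ψ₁ Ψ₂) * |d - 0| := by
        simp only [inner]
        rw [← intervalIntegral.integral_sub ((hii Ψ₁ v).intervalIntegrable _ _)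
          ((hii Ψ₂ v).intervalIntegrable _ _)]
        refine intervalIntegral.norm_integral_le_of_norm_le_const fun r _ => ?_
        rw [← mul_sub, ← mul_sub, norm_mul, norm_mul, Complex.norm_real,
          Real.norm_of_nonneg (Real.exp_pos _).le, ← dist_eq_norm]
        gcongr
        · exact hNC _ _
        · exact BoundedContinuousFunction.dist_coe_le_dist _
      refine h₁.trans ?_
      rw [sub_zero, abs_of_nonneg hd.1]
      have : C * (Real.exp (k * v) * dist Ψ₁ Ψ₂) * d ≤ C * (Real.exp (k * v) * dist Ψ₁ Ψ₂) * L :=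
        mul_le_mul_of_nonneg_left hd.2 (by positivity)
      linarith
    have hexp : ∫ v in (0:ℝ)..u, C * L * dist Ψ₁ Ψ₂ * Real.exp (k * v) =
        C * L * dist Ψ₁ Ψ₂ * ((Real.exp (k * u) - 1) / k) := by
      rw [intervalIntegral.integral_const_mul, intervalIntegral.integral_comp_mul_left _ hk.ne',
        integral_exp, mul_zero, Real.exp_zero, smul_eq_mul]
      ring
    have hdiff : op (fun r v => Ψ₁ (r, v)) d u - op (fun r v => Ψ₂ (r, v)) d u =
        (Real.exp (-(k * u)) : ℂ) * (I * ∫ v in (0:ℝ)..u,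
          (inner (fun r v => Ψ₁ (r, v)) d v - inner (fun r v => Ψ₂ (r, v)) d v)) := by
      simp only [op]
      rw [← mul_sub, ← mul_sub, ← intervalIntegral.integral_sub
        ((hm.fun_add (hi Ψ₁)).intervalIntegrable _ _)
        ((hm.fun_add (hi Ψ₂)).intervalIntegrable _ _)]
      simp only [add_sub_add_left_eq_sub]
    rw [hdiff, norm_mul, norm_mul, Complex.norm_I, one_mul, Complex.norm_real,
      Real.norm_of_nonneg (Real.exp_pos _).le]
    have hle := intervalIntegral.norm_integral_le_of_norm_le hu.1
      (Filter.Eventually.of_forall fun v _ => hinner_le v)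
      (Continuous.intervalIntegrable (μ := volume) (by fun_prop) _ _)
    rw [hexp] at hle
    refine (mul_le_mul_of_nonneg_left hle (Real.exp_pos _).le).trans ?_
    have hmul : Real.exp (-(k * u)) * Real.exp (k * u) = 1 := by
      rw [← Real.exp_add]; simp
    have hkey : Real.exp (-(k * u)) * (C * L * dist Ψ₁ Ψ₂ * ((Real.exp (k * u) - 1) / k)) =
        (C * L / k) * dist Ψ₁ Ψ₂ * (1 - Real.exp (-(k * u))) := by
      linear_combination (C * L * dist Ψ₁ Ψ₂ / k) * hmul
    rw [hkey]
    have h₁ : C * L / k ≤ 1 / 2 := by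
      rw [div_le_iff₀ hk]; simp only [k]; linarith
    have h₂ : 1 - Real.exp (-(k * u)) ≤ 1 := by linarith [Real.exp_pos (-(k * u))]
    calc (C * L / k) * dist Ψ₁ Ψ₂ * (1 - Real.exp (-(k * u)))
        ≤ (C * L / k) * dist Ψ₁ Ψ₂ * 1 := mul_le_mul_of_nonneg_left h₂ (by positivity)
      _ ≤ 1 / 2 * dist Ψ₁ Ψ₂ := by
        rw [mul_one]; exact mul_le_mul_of_nonneg_right h₁ dist_nonneg
  have hT : ContractingWith (1 / 2) T := by
    refine ⟨by norm_num, LipschitzWith.of_dist_le_mul fun Ψ₁ Ψ₂ => ?_⟩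
    refine (BoundedContinuousFunction.dist_le (by positivity)).2 fun p => ?_
    rw [dist_eq_norm]
    simpa [T] using hlip Ψ₁ Ψ₂ (c p.1) (hc_mem _) (c p.2) (hc_mem _)
  let Ψ := ContractingWith.fixedPoint T hT
  have hfix : T Ψ = Ψ := hT.fixedPoint_isFixedPt
  refine ⟨fun d u => (Real.exp (k * u) : ℂ) * Ψ (d, u),
    Continuous.mul (by fun_prop) Ψ.continuous, fun d hd u hu => ?_⟩
  have h : Ψ (d, u) = op (fun r v => Ψ (r, v)) d u := by
    conv_lhs => rw [← hfix]
    simp [T, hc_eq d hd, hc_eq u hu]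
  have hmul : (Real.exp (k * u) : ℂ) * (Real.exp (-(k * u)) : ℂ) = 1 := by
    rw [← Complex.ofReal_mul, ← Real.exp_add]; simp
  simp only
  rw [h]
  simp only [op]
  rw [← mul_assoc, hmul, one_mul]

/-- The function built from a solution of the Goursat-type equation satisfies the integrated form of
the integro-differential equation. -/
lemma transformed_exp_integral_eq {N Φ : ℝ → ℝ → ℂ}
    (hN : Continuous fun p : ℝ × ℝ => N p.1 p.2) (hΦ : Continuous fun p : ℝ × ℝ => Φ p.1 p.2)
    {L : ℝ} (hΦN : ∀ d ∈ Icc 0 L, ∀ u ∈ Icc 0 L, Φ d u =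
      I * ∫ v in (0:ℝ)..u, (N (d + v) v + ∫ r in (0:ℝ)..d, N (d + v) (v + r) * Φ r v))
    (lam : ℂ) {x : ℝ} (hx : x ∈ Icc 0 L) :
    Complex.exp (I * lam * x) * (Complex.exp (-I * lam * x) +
        ∫ t in (0:ℝ)..x, Φ (x - t) t * Complex.exp (-I * lam * t)) =
      1 + ∫ s in (0:ℝ)..x, I * Complex.exp (I * lam * s) * ∫ t in (0:ℝ)..s, N s t *
        (Complex.exp (-I * lam * t) + ∫ w in (0:ℝ)..t, Φ (t - w) w * Complex.exp (-I * lam * w)) := by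
  let R : ℝ → ℝ → ℂ := fun d v => N (d + v) v + ∫ r in (0:ℝ)..d, N (d + v) (v + r) * Φ r v
  have hR : Continuous fun p : ℝ × ℝ => R p.1 p.2 := by
    refine (hN.comp (f := fun p : ℝ × ℝ => (p.1 + p.2, p.2)) (by fun_prop)).add ?_
    refine continuous_integral_of_continuous (X := ℝ × ℝ) (s := fun p => p.1)
      (f := fun p r => N (p.1 + p.2) (p.2 + r) * Φ r p.2) ?_ continuous_fst
    exact (hN.comp (f := fun q : (ℝ × ℝ) × ℝ => (q.1.1 + q.1.2, q.1.2 + q.2)) (by fun_prop)).mul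
      (hΦ.comp (f := fun q : (ℝ × ℝ) × ℝ => (q.2, q.1.2)) (by fun_prop))
  have hexp : ∀ a b : ℝ, Complex.exp (I * lam * ((a - b : ℝ) : ℂ)) =
      Complex.exp (I * lam * a) * Complex.exp (-I * lam * b) := by
    intro a b
    rw [← Complex.exp_add]; congr 1; push_cast; ring
  have hone : Complex.exp (I * lam * x) * Complex.exp (-I * lam * x) = 1 := by
    rw [← hexp]; simp
  have hconv : Complex.exp (I * lam * x) *
      (∫ t in (0:ℝ)..x, Φ (x - t) t * Complex.exp (-I * lam * t)) =
      ∫ d in (0:ℝ)..x, ∫ v in (0:ℝ)..(x - d), I * R d v * Complex.exp (I * lam * d) := by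
    have h₁ := intervalIntegral.integral_comp_sub_left
      (fun d : ℝ => Φ d (x - d) * Complex.exp (I * lam * d)) x (a := 0) (b := x)
    rw [sub_self, sub_zero] at h₁
    rw [← intervalIntegral.integral_const_mul]
    calc _ = ∫ t in (0:ℝ)..x, Φ (x - t) (x - (x - t)) *
          Complex.exp (I * lam * ((x - t : ℝ) : ℂ)) := by
          refine intervalIntegral.integral_congr fun t _ => ?_
          simp only [hexp, sub_sub_cancel]
          ring
      _ = ∫ d in (0:ℝ)..x, Φ d (x - d) * Complex.exp (I * lam * d) := h₁
      _ = _ := by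
          refine intervalIntegral.integral_congr fun d hd => ?_
          rw [uIcc_of_le hx.1] at hd
          rw [intervalIntegral.integral_mul_const, intervalIntegral.integral_const_mul,
            hΦN d ⟨hd.1, hd.2.trans hx.2⟩ (x - d)
              ⟨sub_nonneg.2 hd.2, by linarith [hd.1, hx.2]⟩]
  have hinner : ∀ s ∈ Icc 0 x, ∫ d in (0:ℝ)..s, I * R d (s - d) * Complex.exp (I * lam * d) =
      I * Complex.exp (I * lam * s) * ∫ t in (0:ℝ)..s, N s t *
        (Complex.exp (-I * lam * t) +
          ∫ w in (0:ℝ)..t, Φ (t - w) w * Complex.exp (-I * lam * w)) := by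
    intro s hs
    have h₁ := intervalIntegral.integral_comp_sub_left
      (fun d : ℝ => I * R d (s - d) * Complex.exp (I * lam * d)) s (a := 0) (b := s)
    rw [sub_self, sub_zero] at h₁
    have hNs : Continuous fun t => N s t := hN.comp (f := fun t : ℝ => (s, t)) (by fun_prop)
    have hg : Continuous fun p : ℝ × ℝ =>
        N s (p.1 + p.2) * Φ p.2 p.1 * Complex.exp (-I * lam * p.1) :=
      ((hNs.comp (f := fun p : ℝ × ℝ => p.1 + p.2) (by fun_prop)).mul
        (hΦ.comp (f := fun p : ℝ × ℝ => (p.2, p.1)) (by fun_prop))).mul (by fun_prop)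
    have hfirst : Continuous fun t : ℝ => N s t * Complex.exp (-I * lam * t) :=
      hNs.mul (by fun_prop)
    have hsecond : Continuous fun w : ℝ => ∫ r in (0:ℝ)..(s - w),
        N s (w + r) * Φ r w * Complex.exp (-I * lam * w) :=
      continuous_integral_of_continuous hg (by fun_prop)
    have hthird : Continuous fun t : ℝ => ∫ w in (0:ℝ)..t,
        N s (w + (t - w)) * Φ (t - w) w * Complex.exp (-I * lam * w) :=
      continuous_integral_of_continuous (s := fun t => t)
        (f := fun t w => N s (w + (t - w)) * Φ (t - w) w * Complex.exp (-I * lam * w))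
        (hg.comp (f := fun q : ℝ × ℝ => (q.2, q.1 - q.2)) (by fun_prop)) continuous_id
    rw [← h₁]
    calc _ = ∫ w in (0:ℝ)..s, I * Complex.exp (I * lam * s) *
          (N s w * Complex.exp (-I * lam * w) + ∫ r in (0:ℝ)..(s - w),
            N s (w + r) * Φ r w * Complex.exp (-I * lam * w)) := by
          refine intervalIntegral.integral_congr fun w _ => ?_
          simp only [hexp, sub_sub_cancel, R, sub_add_cancel]
          rw [intervalIntegral.integral_mul_const]
          ring
      _ = _ := by
          rw [intervalIntegral.integral_const_mul, intervalIntegral.integral_add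
            (hfirst.intervalIntegrable _ _) (hsecond.intervalIntegrable _ _),
            integral_triangle_swap hg hs.1, ← intervalIntegral.integral_add
            (hfirst.intervalIntegrable _ _) (hthird.intervalIntegrable _ _)]
          congr 1
          refine intervalIntegral.integral_congr fun t _ => ?_
          simp only [add_sub_cancel, mul_assoc]
          rw [intervalIntegral.integral_const_mul, mul_add]
  have hg : Continuous fun p : ℝ × ℝ => I * R p.1 p.2 * Complex.exp (I * lam * p.1) :=
    (continuous_const.mul hR).mul (by fun_prop)
  rw [mul_add, hone, hconv, integral_triangle_swap hg hx.1]
  congr 1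
  refine intervalIntegral.integral_congr fun s hs => ?_
  rw [uIcc_of_le hx.1] at hs
  exact hinner s hs

/-- Continuous solutions of the integrated integro-differential equation agree on `[0, L]`. -/
lemma integral_equation_unique {N : ℝ → ℝ → ℂ} (hN : Continuous fun p : ℝ × ℝ => N p.1 p.2)
    {C : ℝ} (hC : 0 ≤ C) (hNC : ∀ x t, ‖N x t‖ ≤ C) {L : ℝ} {lam : ℂ} {y z : ℝ → ℂ}
    (hy : Continuous y) (hz : Continuous z)
    (hye : ∀ x ∈ Icc 0 L, Complex.exp (I * lam * x) * y x =
      1 + ∫ s in (0:ℝ)..x, I * Complex.exp (I * lam * s) * ∫ t in (0:ℝ)..s, N s t * y t)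
    (hze : ∀ x ∈ Icc 0 L, Complex.exp (I * lam * x) * z x =
      1 + ∫ s in (0:ℝ)..x, I * Complex.exp (I * lam * s) * ∫ t in (0:ℝ)..s, N s t * z t) :
    ∀ x ∈ Icc 0 L, y x = z x := by
  have hexp : Continuous fun x : ℝ => Complex.exp (I * lam * x) := by fun_prop
  have hexp' : Continuous fun x : ℝ => Complex.exp (-(I * lam * x)) := by fun_prop
  obtain ⟨A, hA⟩ := (isCompact_Icc (a := (0:ℝ)) (b := L)).exists_bound_of_continuousOn
    hexp.continuousOn
  obtain ⟨A', hA'⟩ := (isCompact_Icc (a := (0:ℝ)) (b := L)).exists_bound_of_continuousOn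
    hexp'.continuousOn
  have hNy : ∀ f : ℝ → ℂ, Continuous f → ∀ s, Continuous fun t => N s t * f t := fun f hf s =>
    (hN.comp (f := fun t : ℝ => (s, t)) (by fun_prop)).mul hf
  have hint : ∀ f : ℝ → ℂ, Continuous f → Continuous fun s : ℝ =>
      I * Complex.exp (I * lam * s) * ∫ t in (0:ℝ)..s, N s t * f t := fun f hf =>
    (continuous_const.mul hexp).mul (continuous_integral_of_continuous (s := fun s => s)
      (f := fun s t => N s t * f t) (hN.mul (hf.comp continuous_snd)) continuous_id)
  have hdc : Continuous fun t => y t - z t := hy.sub hz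
  suffices h : ∀ x ∈ Icc 0 L, y x - z x = 0 from fun x hx => sub_eq_zero.1 (h x hx)
  refine eq_zero_of_norm_le_mul_integral_norm hdc (K := A' * (A * C * L)) fun x hx => ?_
  have hL : 0 ≤ L := hx.1.trans hx.2
  have hA₀ : 0 ≤ A := (norm_nonneg _).trans (hA 0 ⟨le_rfl, hL⟩)
  have hA₀' : 0 ≤ A' := (norm_nonneg _).trans (hA' 0 ⟨le_rfl, hL⟩)
  have heq : y x - z x = Complex.exp (-(I * lam * x)) * ∫ s in (0:ℝ)..x,
      I * Complex.exp (I * lam * s) * ∫ t in (0:ℝ)..s, N s t * (y t - z t) := by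
    have h₁ : ∫ s in (0:ℝ)..x, I * Complex.exp (I * lam * s) *
        ∫ t in (0:ℝ)..s, N s t * (y t - z t) = Complex.exp (I * lam * x) * (y x - z x) := by
      rw [mul_sub, hye x hx, hze x hx, add_sub_add_left_eq_sub, ← intervalIntegral.integral_sub
        ((hint y hy).intervalIntegrable _ _) ((hint z hz).intervalIntegrable _ _)]
      refine intervalIntegral.integral_congr fun s _ => ?_
      simp only [mul_sub]
      rw [intervalIntegral.integral_sub ((hNy y hy s).intervalIntegrable _ _)
        ((hNy z hz s).intervalIntegrable _ _), mul_sub]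
    rw [h₁, ← mul_assoc, ← Complex.exp_add, neg_add_cancel, Complex.exp_zero, one_mul]
  set J := ∫ t in (0:ℝ)..x, ‖y t - z t‖
  have hJ₀ : 0 ≤ J := intervalIntegral.integral_nonneg hx.1 fun _ _ => norm_nonneg _
  have hin : ∀ s ∈ Icc 0 x, ‖∫ t in (0:ℝ)..s, N s t * (y t - z t)‖ ≤ C * J := by
    intro s hs
    have h₁ := intervalIntegral.norm_integral_le_of_norm_le (μ := volume)
      (f := fun t => N s t * (y t - z t)) (g := fun t => C * ‖y t - z t‖) hs.1
      (Filter.Eventually.of_forall fun t _ => by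
        rw [norm_mul]; exact mul_le_mul_of_nonneg_right (hNC s t) (norm_nonneg _))
      ((continuous_const.mul hdc.norm).intervalIntegrable _ _)
    rw [intervalIntegral.integral_const_mul] at h₁
    refine h₁.trans (mul_le_mul_of_nonneg_left ?_ hC)
    exact intervalIntegral.integral_mono_interval le_rfl hs.1 hs.2
      (Filter.Eventually.of_forall fun _ => norm_nonneg _) (hdc.norm.intervalIntegrable _ _)
  have hout : ‖∫ s in (0:ℝ)..x, I * Complex.exp (I * lam * s) *
      ∫ t in (0:ℝ)..s, N s t * (y t - z t)‖ ≤ A * (C * J) * |x - 0| := by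
    refine intervalIntegral.norm_integral_le_of_norm_le_const fun s hs => ?_
    rw [uIoc_of_le hx.1] at hs
    rw [norm_mul, norm_mul, Complex.norm_I, one_mul]
    exact mul_le_mul (hA s ⟨hs.1.le, hs.2.trans hx.2⟩) (hin s ⟨hs.1.le, hs.2⟩) (norm_nonneg _) hA₀
  rw [sub_zero, abs_of_nonneg hx.1] at hout
  rw [heq, norm_mul]
  have hxL : A * (C * J) * x ≤ A * (C * J) * L := mul_le_mul_of_nonneg_left hx.2 (by positivity)
  calc _ ≤ A' * (A * (C * J) * L) :=
        mul_le_mul (hA' x hx) (hout.trans hxL) (norm_nonneg _) hA₀'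
    _ = _ := by ring

/-- A solution of the integro-differential equation with initial value `1` satisfies the integrated
form of the equation. -/
lemma integral_equation_of_hasDerivWithinAt {N : ℝ → ℝ → ℂ}
    (hN : Continuous fun p : ℝ × ℝ => N p.1 p.2) {L : ℝ} {lam : ℂ} {y y' : ℝ → ℂ}
    (hy : Continuous y)
    (hderiv : ∀ x ∈ Icc 0 L, HasDerivWithinAt y (y' x) (Icc 0 L) x)
    (heq : ∀ x ∈ Icc 0 L, I * y' x + (∫ t in (0:ℝ)..x, N x t * y t) = lam * y x)
    (hy₀ : y 0 = 1) {x : ℝ} (hx : x ∈ Icc 0 L) :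
    Complex.exp (I * lam * x) * y x =
      1 + ∫ s in (0:ℝ)..x, I * Complex.exp (I * lam * s) * ∫ t in (0:ℝ)..s, N s t * y t := by
  have hexp : Continuous fun x : ℝ => Complex.exp (I * lam * x) := by fun_prop
  have hint : Continuous fun s : ℝ =>
      I * Complex.exp (I * lam * s) * ∫ t in (0:ℝ)..s, N s t * y t :=
    (continuous_const.mul hexp).mul (continuous_integral_of_continuous (s := fun s => s)
      (f := fun s t => N s t * y t) (hN.mul (hy.comp continuous_snd)) continuous_id)
  have hftc := intervalIntegral.integral_eq_sub_of_hasDerivAt_of_le hx.1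
    (f := fun s : ℝ => Complex.exp (I * lam * s) * y s)
    (f' := fun s : ℝ => I * Complex.exp (I * lam * s) * ∫ t in (0:ℝ)..s, N s t * y t)
    (hexp.mul hy).continuousOn (fun s hs => ?_) (hint.intervalIntegrable _ _)
  · rw [hftc, hy₀]; simp
  · have hs' : s ∈ Icc 0 L := ⟨hs.1.le, hs.2.le.trans hx.2⟩
    have hys : HasDerivAt y (y' s) s :=
      (hderiv s hs').hasDerivAt (Icc_mem_nhds hs.1 (hs.2.trans_le hx.2))
    have hes : HasDerivAt (fun s : ℝ => Complex.exp (I * lam * s))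
        (Complex.exp (I * lam * s) * (I * lam)) s := by
      have h := ((hasDerivAt_id s).ofReal_comp.const_mul (I * lam)).cexp
      simpa using h
    refine (hes.fun_mul hys).congr_deriv ?_
    have h := heq s hs'
    linear_combination Complex.exp (I * lam * s) * y' s * Complex.I_mul_I -
      Complex.exp (I * lam * s) * I * h

/-- (Lemma 1) The solution `e(·,λ)` of equation (1) with `e(0,λ) = 1` admits the
transformation-operator representation
`e(x,λ) = exp(−iλx) + ∫₀ˣ G(x,t) exp(−iλt) dt` with `G` continuous on the triangle,
independent of `λ`, `G(x,0) = 0` and `G(x,x) = i ∫₀ˣ M(t,t) dt`. -/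
theorem stmt_1 (M : ℝ → ℝ → ℂ)
    (hM : ContinuousOn (fun p : ℝ × ℝ => M p.1 p.2) Triangle)
    (e : ℝ → ℂ → ℂ)
    (he : ∀ lam : ℂ, ∃ e' : ℝ → ℂ,
      (∀ x ∈ Icc (0:ℝ) Real.pi,
        HasDerivWithinAt (fun x => e x lam) (e' x) (Icc 0 Real.pi) x ∧
        Complex.I * e' x + (∫ t in (0:ℝ)..x, M x t * e t lam) = lam * e x lam) ∧
      e 0 lam = 1) :
    ∃ G : ℝ → ℝ → ℂ,
      ContinuousOn (fun p : ℝ × ℝ => G p.1 p.2) Triangle ∧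
      (∀ x ∈ Icc (0:ℝ) Real.pi, ∀ lam : ℂ,
        e x lam = Complex.exp (-Complex.I * lam * x)
          + ∫ t in (0:ℝ)..x, G x t * Complex.exp (-Complex.I * lam * t)) ∧
      (∀ x ∈ Icc (0:ℝ) Real.pi, G x 0 = 0) ∧
      (∀ x ∈ Icc (0:ℝ) Real.pi, G x x = Complex.I * ∫ t in (0:ℝ)..x, M t t) := by
  have hpi := Real.pi_pos.le
  obtain ⟨N, hN, ⟨C, hC, hNC⟩, hNM⟩ := exists_bounded_continuous_extension M hM
  obtain ⟨Φ, hΦ, hΦN⟩ := exists_goursat_solution hN hC hNC hpi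
  refine ⟨fun x t => Φ (x - t) t, ?_, ?_, ?_, ?_⟩
  · exact (hΦ.comp (f := fun p : ℝ × ℝ => (p.1 - p.2, p.2)) (by fun_prop)).continuousOn
  · intro x hx lam
    obtain ⟨e', heq, he₀⟩ := he lam
    have hcont : ContinuousOn (fun x => e x lam) (Icc 0 Real.pi) := fun x hx =>
      (heq x hx).1.continuousWithinAt
    let y : ℝ → ℂ := IccExtend hpi (domRestrict (Icc 0 Real.pi) fun x => e x lam)
    have hy : Continuous y := hcont.domRestrict.Icc_extend'
    have hye : ∀ x ∈ Icc 0 Real.pi, y x = e x lam := fun x hx => IccExtend_of_mem hpi _ hx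
    have hz : Continuous fun x : ℝ => Complex.exp (-I * lam * x) +
        ∫ t in (0:ℝ)..x, Φ (x - t) t * Complex.exp (-I * lam * t) := by
      refine Continuous.add (by fun_prop) (continuous_integral_of_continuous (s := fun x => x)
        (f := fun x t => Φ (x - t) t * Complex.exp (-I * lam * t)) ?_ continuous_id)
      exact (hΦ.comp (f := fun p : ℝ × ℝ => (p.1 - p.2, p.2)) (by fun_prop)).mul (by fun_prop)
    rw [← hye x hx]
    refine integral_equation_unique hN hC hNC hy hz (fun s hs => ?_)
      (fun s hs => transformed_exp_integral_eq hN hΦ hΦN lam hs) x hx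
    refine integral_equation_of_hasDerivWithinAt hN (y' := e') hy
      (fun t ht => (heq t ht).1.congr hye (hye t ht)) (fun t ht => ?_) ?_ hs
    · rw [hye t ht, ← (heq t ht).2]
      congr 1
      refine intervalIntegral.integral_congr fun r hr => ?_
      rw [uIcc_of_le ht.1] at hr
      rw [hNM t r hr.1 hr.2 ht.2, hye r ⟨hr.1, hr.2.trans ht.2⟩]
    · rw [hye 0 ⟨le_rfl, hpi⟩, he₀]
  · intro x hx
    simp only [sub_zero]
    rw [hΦN x hx 0 ⟨le_rfl, hpi⟩]
    simp
  · intro x hx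
    simp only [sub_self]
    rw [hΦN 0 ⟨le_rfl, hpi⟩ x hx]
    congr 1
    refine intervalIntegral.integral_congr fun t ht => ?_
    rw [uIcc_of_le hx.1] at ht
    simp [hNM t t ht.1 le_rfl (ht.2.trans hx.2)]
end

section
/- Let M be a complex-valued continuous kernel on the triangle {(x,t) : 0 ≤ t ≤ x ≤ π}. Then for every λ ∈ ℂ there exists a unique differentiable function ψ : [0,π] → ℂ satisfying the adjoint equation (13): −i·ψ'(x) + ∫ₓ^π M(t,x)·ψ(t) dt = λ·ψ(x) for x ∈ [0,π], with ψ(π) = 1. Moreover, there exists a continuous function K₁ on the triangle {(x,t) : 0 ≤ t ≤ x ≤ π}, independent of λ, such that w(x,λ) := ψ(π−x,λ) satisfies w(x,λ) = exp(−iλx) + ∫₀ˣ K₁(x,t)·exp(−iλt) dt for all x ∈ [0,π] and λ ∈ ℂ. -/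
open Complex MeasureTheory Set Real

/-- Fubini's theorem on a triangle. -/
theorem intervalIntegral_swap_triangle {F : ℝ → ℝ → ℂ} (hF : Continuous F.uncurry)
    {x : ℝ} (hx : 0 ≤ x) :
    ∫ s in (0:ℝ)..x, ∫ u in (0:ℝ)..s, F s u = ∫ u in (0:ℝ)..x, ∫ s in u..x, F s u := by
  set G : ℝ → ℝ → ℂ := fun s u => {p : ℝ × ℝ | p.2 ≤ p.1}.indicator F.uncurry (s, u) with hG
  have hswap : ∫ s in (0:ℝ)..x, ∫ u in (0:ℝ)..x, G s u
      = ∫ u in (0:ℝ)..x, ∫ s in (0:ℝ)..x, G s u := by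
    apply intervalIntegral_intervalIntegral_swap
    have hmeas : MeasurableSet {p : ℝ × ℝ | p.2 ≤ p.1} :=
      measurableSet_le measurable_snd measurable_fst
    have hint : IntegrableOn F.uncurry (uIoc 0 x ×ˢ uIoc 0 x) := by
      rw [uIoc_of_le hx]
      exact (hF.continuousOn.integrableOn_compact (isCompact_Icc.prod isCompact_Icc)).mono_set
        (prod_mono Ioc_subset_Icc_self Ioc_subset_Icc_self)
    exact hint.indicator hmeas
  have hleft : ∀ s ∈ uIcc 0 x, ∫ u in (0:ℝ)..x, G s u = ∫ u in (0:ℝ)..s, F s u := by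
    intro s hs
    rw [uIcc_of_le hx] at hs
    exact intervalIntegral.integral_indicator hs
  have hright : ∀ u ∈ uIcc 0 x, ∫ s in (0:ℝ)..x, G s u = ∫ s in u..x, F s u := by
    intro u hu
    rw [uIcc_of_le hx] at hu
    rw [intervalIntegral.integral_of_le hx, intervalIntegral.integral_of_le hu.2,
      integral_Ioc_eq_integral_Ioo, ← integral_Icc_eq_integral_Ioc,
      ← integral_Icc_eq_integral_Ioo]
    have : (fun s => G s u) = (Ici u).indicator (fun s => F s u) := by
      ext s
      simp [hG, indicator, Function.uncurry]
    rw [this, setIntegral_indicator measurableSet_Ici]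
    congr 2
    ext s
    simp only [mem_inter_iff, mem_Icc, mem_Ici]
    exact ⟨fun h => ⟨h.2, h.1.2⟩, fun h => ⟨⟨hu.1.trans h.1, h.2⟩, h.1⟩⟩
  rw [← intervalIntegral.integral_congr hleft, hswap, intervalIntegral.integral_congr hright]

/-- The derivative in `t` prescribed for a transformation kernel written in the coordinates
`L d t = K (d + t) t`, when `K` represents the solution of the Volterra
integro-differential equation with kernel `N`. -/
noncomputable def kernelSource (N L : ℝ → ℝ → ℂ) (d u : ℝ) : ℂ :=
  N (d + u) u + ∫ v in (0:ℝ)..d, N (d + u) (u + v) * L v u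

theorem continuous_kernelSource {N L : ℝ → ℝ → ℂ} (hN : Continuous N.uncurry)
    (hL : Continuous L.uncurry) : Continuous (kernelSource N L).uncurry := by
  have hN' : ∀ {X : Type} [TopologicalSpace X] {f g : X → ℝ}, Continuous f → Continuous g →
    Continuous fun x => N (f x) (g x) := fun hf hg => hN.comp (hf.prodMk hg)
  have hL' : ∀ {X : Type} [TopologicalSpace X] {f g : X → ℝ}, Continuous f → Continuous g →
    Continuous fun x => L (f x) (g x) := fun hf hg => hL.comp (hf.prodMk hg)
  refine (hN' (by fun_prop) (by fun_prop)).add ?_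
  apply intervalIntegral.continuous_parametric_intervalIntegral_of_continuous
    (f := fun (p : ℝ × ℝ) v => N (p.1 + p.2) (p.2 + v) * L v p.2) _ continuous_fst
  exact (hN' (by fun_prop) (by fun_prop)).mul (hL' (by fun_prop) (by fun_prop))

theorem volterra_convolution {N L : ℝ → ℝ → ℂ} (hN : Continuous N.uncurry)
    (hL : Continuous L.uncurry) {e : ℝ → ℂ} (he : Continuous e) {r : ℝ} (hr : 0 ≤ r) :
    ∫ d in (0:ℝ)..r, kernelSource N L d (r - d) * e (r - d)
      = ∫ s in (0:ℝ)..r, N r s * (e s + ∫ u in (0:ℝ)..s, L (s - u) u * e u) := by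
  have hN' : ∀ {X : Type} [TopologicalSpace X] {f g : X → ℝ}, Continuous f → Continuous g →
    Continuous fun x => N (f x) (g x) := fun hf hg => hN.comp (hf.prodMk hg)
  have hL' : ∀ {X : Type} [TopologicalSpace X] {f g : X → ℝ}, Continuous f → Continuous g →
    Continuous fun x => L (f x) (g x) := fun hf hg => hL.comp (hf.prodMk hg)
  have hsub : ∀ u, kernelSource N L (r - u) u * e u
      = N r u * e u + ∫ s in u..r, N r s * (L (s - u) u * e u) := by
    intro u
    have := intervalIntegral.integral_comp_add_left
      (fun s => N r s * (L (s - u) u * e u)) u (a := 0) (b := r - u)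
    simp only [add_zero, add_sub_cancel, add_sub_cancel_left] at this
    rw [← this, kernelSource, sub_add_cancel, add_mul, ← intervalIntegral.integral_mul_const]
    simp only [mul_assoc]
  have hF : Continuous (fun s u : ℝ => N r s * (L (s - u) u * e u)).uncurry :=
    (hN' (by fun_prop) (by fun_prop)).mul
      ((hL' (by fun_prop) (by fun_prop)).mul (he.comp (by fun_prop)))
  have hswap := intervalIntegral_swap_triangle hF hr
  have hflip := intervalIntegral.integral_comp_sub_left
    (fun u => kernelSource N L (r - u) u * e u) r (a := 0) (b := r)
  simp only [sub_sub_cancel, sub_self, sub_zero] at hflip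
  rw [hflip]
  simp only [hsub, mul_add]
  have hNe : Continuous fun s => N r s * e s :=
    (hN' (by fun_prop) (by fun_prop)).mul he
  have hi1 : Continuous fun u => ∫ s in u..r, N r s * (L (s - u) u * e u) := by
    simp only [intervalIntegral.integral_symm r]
    refine (intervalIntegral.continuous_parametric_intervalIntegral_of_continuous
      (f := fun u s => N r s * (L (s - u) u * e u)) ?_ continuous_id).neg
    exact hF.comp continuous_swap
  have hi2 : Continuous fun s => N r s * ∫ u in (0:ℝ)..s, L (s - u) u * e u := by
    refine (hN' (by fun_prop) (by fun_prop)).mul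
      (intervalIntegral.continuous_parametric_intervalIntegral_of_continuous
      (f := fun s u => L (s - u) u * e u) ?_ continuous_id)
    exact (hL' (by fun_prop) (by fun_prop)).mul (he.comp (by fun_prop))
  rw [intervalIntegral.integral_add (hNe.intervalIntegrable _ _) (hi1.intervalIntegrable _ _),
    intervalIntegral.integral_add (hNe.intervalIntegrable _ _) (hi2.intervalIntegrable _ _),
    ← hswap]
  simp only [intervalIntegral.integral_const_mul]

theorem integral_kernel_eq_duhamel {N L : ℝ → ℝ → ℂ} (hN : Continuous N.uncurry)
    (hL : Continuous L.uncurry)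
    (hLN : ∀ d ∈ Icc 0 π, ∀ t ∈ Icc 0 π, L d t = ∫ u in (0:ℝ)..t, kernelSource N L d u)
    {c : ℂ} {x : ℝ} (hx : x ∈ Icc 0 π) :
    ∫ t in (0:ℝ)..x, L (x - t) t * exp (c * t)
      = ∫ r in (0:ℝ)..x, exp (c * (x - r)) * ∫ s in (0:ℝ)..r, N r s *
        (exp (c * s) + ∫ u in (0:ℝ)..s, L (s - u) u * exp (c * u)) := by
  have hg := continuous_kernelSource hN hL
  have hF : Continuous
      (fun r d : ℝ => kernelSource N L d (r - d) * exp (c * ((x - d : ℝ) : ℂ))).uncurry := by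
    have : Continuous fun p : ℝ × ℝ => kernelSource N L p.2 (p.1 - p.2) :=
      hg.comp (by fun_prop : Continuous fun p : ℝ × ℝ => (p.2, p.1 - p.2))
    refine this.mul (by fun_prop)
  have hflip := intervalIntegral.integral_comp_sub_left
    (fun t => L (x - t) t * exp (c * t)) x (a := 0) (b := x)
  simp only [sub_sub_cancel, sub_self, sub_zero] at hflip
  rw [← hflip]
  calc _ = ∫ d in (0:ℝ)..x, ∫ r in d..x,
          kernelSource N L d (r - d) * exp (c * ((x - d : ℝ) : ℂ)) := by
        refine intervalIntegral.integral_congr fun d hd => ?_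
        rw [uIcc_of_le hx.1] at hd
        have hd' : d ∈ Icc 0 π := ⟨hd.1, hd.2.trans hx.2⟩
        have hxd : x - d ∈ Icc 0 π := ⟨by linarith [hd.2], by linarith [hd.1, hx.2]⟩
        simp only [hLN d hd' _ hxd, intervalIntegral.integral_mul_const]
        rw [intervalIntegral.integral_comp_sub_right (fun u => kernelSource N L d u) d, sub_self]
    _ = ∫ r in (0:ℝ)..x, ∫ d in (0:ℝ)..r,
          kernelSource N L d (r - d) * exp (c * ((x - d : ℝ) : ℂ)) :=
        (intervalIntegral_swap_triangle hF hx.1).symm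
    _ = _ := by
        refine intervalIntegral.integral_congr fun r hr => ?_
        rw [uIcc_of_le hx.1] at hr
        rw [← volterra_convolution hN hL (e := fun t => exp (c * t)) (by fun_prop) hr.1,
          ← intervalIntegral.integral_const_mul]
        refine intervalIntegral.integral_congr fun d _ => ?_
        rw [mul_left_comm, ← Complex.exp_add]
        congr 2
        push_cast
        ring

/-- On `[0,π]`, `w` solves `w' x = c * w x + ∫₀ˣ N x s * w s ds`. -/
def IsVolterraSolution (N : ℝ → ℝ → ℂ) (c : ℂ) (w : ℝ → ℂ) : Prop :=
  ∀ x ∈ Icc 0 π, HasDerivWithinAt w (c * w x + ∫ s in (0:ℝ)..x, N x s * w s) (Icc 0 π) x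

theorem isVolterraSolution_of_kernel {N L : ℝ → ℝ → ℂ} (hN : Continuous N.uncurry)
    (hL : Continuous L.uncurry)
    (hLN : ∀ d ∈ Icc 0 π, ∀ t ∈ Icc 0 π, L d t = ∫ u in (0:ℝ)..t, kernelSource N L d u)
    (c : ℂ) :
    IsVolterraSolution N c
      fun x => exp (c * x) + ∫ t in (0:ℝ)..x, L (x - t) t * exp (c * t) := by
  set w : ℝ → ℂ := fun x => exp (c * x) + ∫ t in (0:ℝ)..x, L (x - t) t * exp (c * t) with hw
  set H : ℝ → ℂ := fun r => ∫ s in (0:ℝ)..r, N r s * w s with hH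
  have hwc : Continuous w := by
    refine Continuous.add (by fun_prop)
      (intervalIntegral.continuous_parametric_intervalIntegral_of_continuous
      (f := fun s u => L (s - u) u * exp (c * u)) ?_ continuous_id)
    exact (hL.comp (by fun_prop : Continuous fun p : ℝ × ℝ => (p.1 - p.2, p.2))).mul
      (by fun_prop)
  have hHc : Continuous H :=
    intervalIntegral.continuous_parametric_intervalIntegral_of_continuous
      (f := fun r s => N r s * w s) (hN.mul (hwc.comp continuous_snd)) continuous_id
  have heq : ∀ x ∈ Icc 0 π,
      w x = exp (c * x) * (1 + ∫ r in (0:ℝ)..x, exp (-(c * r)) * H r) := by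
    intro x hx
    rw [mul_add, mul_one, ← intervalIntegral.integral_const_mul]
    simp only [hw]
    rw [integral_kernel_eq_duhamel hN hL hLN hx]
    congr 1
    refine intervalIntegral.integral_congr fun r _ => ?_
    simp only [hH, hw]
    rw [← mul_assoc, ← Complex.exp_add]
    congr 2
    ring
  intro x hx
  have hexp : HasDerivAt (fun x : ℝ => exp (c * x)) (exp (c * x) * c) x := by
    simpa using ((hasDerivAt_id x).ofReal_comp.const_mul c).cexp
  have hint : HasDerivAt (fun x : ℝ => 1 + ∫ r in (0:ℝ)..x, exp (-(c * r)) * H r)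
      (exp (-(c * x)) * H x) x :=
    (intervalIntegral.integral_hasDerivAt_right
      (Continuous.intervalIntegrable (by fun_prop) _ _)
      (Continuous.stronglyMeasurableAtFilter (by fun_prop) _ _)
      (Continuous.continuousAt (by fun_prop))).const_add 1
  refine ((hexp.mul hint).hasDerivWithinAt.congr heq (heq x hx)).congr_deriv ?_
  rw [← mul_assoc (Complex.exp _), ← Complex.exp_add, add_neg_cancel, Complex.exp_zero, one_mul,
    mul_right_comm, ← heq x hx, mul_comm]

theorem IsVolterraSolution.continuousOn {N : ℝ → ℝ → ℂ} {c : ℂ} {w : ℝ → ℂ}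
    (h : IsVolterraSolution N c w) : ContinuousOn w (Icc 0 π) :=
  fun x hx => (h x hx).continuousWithinAt

theorem IsVolterraSolution.sub {N : ℝ → ℝ → ℂ} (hN : Continuous N.uncurry) {c : ℂ}
    {w₁ w₂ : ℝ → ℂ} (h₁ : IsVolterraSolution N c w₁) (h₂ : IsVolterraSolution N c w₂) :
    IsVolterraSolution N c (w₁ - w₂) := by
  intro x hx
  refine ((h₁ x hx).sub (h₂ x hx)).congr_deriv ?_
  have hi : ∀ {w : ℝ → ℂ}, IsVolterraSolution N c w →
      IntervalIntegrable (fun s => N x s * w s) volume 0 x := by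
    intro w hw
    refine ContinuousOn.intervalIntegrable ?_
    rw [uIcc_of_le hx.1]
    exact (hN.comp (by fun_prop : Continuous fun s : ℝ => (x, s))).continuousOn.mul
      (hw.continuousOn.mono (Icc_subset_Icc_right hx.2))
  simp only [Pi.sub_apply, mul_sub]
  rw [intervalIntegral.integral_sub (hi h₁) (hi h₂)]
  ring

theorem IsVolterraSolution.eq_zero {N : ℝ → ℝ → ℂ} {C : ℝ} (hC : ∀ x s, ‖N x s‖ ≤ C)
    {c : ℂ} {w : ℝ → ℂ} (h : IsVolterraSolution N c w) (h0 : w 0 = 0) :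
    ∀ x ∈ Icc 0 π, w x = 0 := by
  have hC0 : 0 ≤ C := (norm_nonneg _).trans (hC 0 0)
  set v : ℝ → ℂ := IccExtend pi_pos.le ((Icc 0 π).domRestrict w) with hv
  have hvc : Continuous v := h.continuousOn.domRestrict.Icc_extend'
  have hvw : ∀ x ∈ Icc 0 π, v x = w x := fun x hx => IccExtend_of_mem _ _ hx
  have key : ∀ x ∈ Icc 0 π, (w x, ∫ s in (0:ℝ)..x, ‖v s‖) = 0 := by
    refine eq_zero_of_abs_deriv_le_mul_abs_self_of_eq_zero_right
      (f' := fun x => (c * w x + ∫ s in (0:ℝ)..x, N x s * w s, ‖v x‖)) (K := ‖c‖ + C + 1)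
      ?_ ?_ (by simp [h0]) ?_
    · exact h.continuousOn.prodMk (intervalIntegral.continuous_primitive
        (fun a b => hvc.norm.intervalIntegrable a b) 0).continuousOn
    · intro x hx
      refine HasDerivWithinAt.prodMk ?_ ?_
      · exact (h x ⟨hx.1, hx.2.le⟩).mono_of_mem_nhdsWithin
          (Filter.mem_of_superset (Icc_mem_nhdsGE hx.2) (Icc_subset_Icc_left hx.1))
      · exact (intervalIntegral.integral_hasDerivAt_right (hvc.norm.intervalIntegrable _ _)
          (hvc.norm.stronglyMeasurableAtFilter _ _) hvc.norm.continuousAt).hasDerivWithinAt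
    · intro x hx
      have hx' : x ∈ Icc 0 π := ⟨hx.1, hx.2.le⟩
      set m := ∫ s in (0:ℝ)..x, ‖v s‖ with hm
      have hm0 : 0 ≤ m := intervalIntegral.integral_nonneg hx.1 fun _ _ => norm_nonneg _
      have hint : ‖∫ s in (0:ℝ)..x, N x s * w s‖ ≤ C * m := by
        rw [hm, ← intervalIntegral.integral_const_mul]
        refine intervalIntegral.norm_integral_le_of_norm_le hx.1 (.of_forall fun s hs => ?_)
          ((hvc.norm.const_mul C).intervalIntegrable _ _)
        rw [norm_mul, hvw s ⟨hs.1.le, hs.2.trans hx'.2⟩]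
        exact mul_le_mul_of_nonneg_right (hC x s) (norm_nonneg _)
      rw [Prod.norm_mk, Prod.norm_mk, hvw x hx', norm_norm, Real.norm_of_nonneg hm0]
      set b := max ‖w x‖ m
      have hb1 : ‖w x‖ ≤ b := le_max_left _ _
      have hb2 : m ≤ b := le_max_right _ _
      have hb0 : 0 ≤ b := hm0.trans hb2
      have h1 : ‖c * w x + ∫ s in (0:ℝ)..x, N x s * w s‖ ≤ ‖c‖ * b + C * b := by
        refine (norm_add_le _ _).trans (add_le_add ?_ ?_)
        · rw [norm_mul]; gcongr
        · exact hint.trans (by gcongr)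
      have h2 : 0 ≤ ‖c‖ * b + C * b := by positivity
      exact max_le (by linarith) (by linarith)
  exact fun x hx => congrArg Prod.fst (key x hx)

theorem exists_volterraKernel {N : ℝ → ℝ → ℂ} (hN : Continuous N.uncurry) {C : ℝ}
    (hC : ∀ x s, ‖N x s‖ ≤ C) :
    ∃ L : ℝ → ℝ → ℂ, Continuous L.uncurry ∧
      ∀ d ∈ Icc 0 π, ∀ t ∈ Icc 0 π, L d t = ∫ u in (0:ℝ)..t, kernelSource N L d u := by
  have hC0 : 0 ≤ C := (norm_nonneg _).trans (hC 0 0)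
  set μ : ℝ := 2 * (C * π) + 1 with hμ
  have hμ0 : 0 < μ := by positivity
  let pr : ℝ → Icc 0 π := projIcc 0 π pi_pos.le
  have hpr : Continuous pr := continuous_projIcc
  -- `E P` extends `P` to the plane and undoes the weight `exp (-μ t)` that makes `T` contract.
  let E : C(Icc 0 π × Icc 0 π, ℂ) → ℝ → ℝ → ℂ :=
    fun P d t => (Real.exp (μ * t) : ℂ) * P (pr d, pr t)
  have hE : ∀ P, Continuous (E P).uncurry := fun P => by
    refine Continuous.mul (by fun_prop) (P.continuous.comp ?_)
    exact (hpr.comp continuous_fst).prodMk (hpr.comp continuous_snd)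
  have hprim : ∀ P, Continuous fun p : Icc 0 π × Icc 0 π =>
      (Real.exp (-(μ * p.2)) : ℂ) *
        ∫ u in (0:ℝ)..p.2, kernelSource N (E P) p.1 u := fun P => by
    refine Continuous.mul (by fun_prop)
      (intervalIntegral.continuous_parametric_intervalIntegral_of_continuous
        (f := fun (p : Icc 0 π × Icc 0 π) u => kernelSource N (E P) p.1 u) ?_ (by fun_prop))
    exact (continuous_kernelSource hN (hE P)).comp
      (by fun_prop : Continuous fun q : (Icc 0 π × Icc 0 π) × ℝ => ((q.1.1 : ℝ), q.2))
  let T : C(Icc 0 π × Icc 0 π, ℂ) → C(Icc 0 π × Icc 0 π, ℂ) := fun P => ⟨_, hprim P⟩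
  have hdiff : ∀ P Q, ∀ d ∈ Icc 0 π, ∀ u,
      ‖kernelSource N (E P) d u - kernelSource N (E Q) d u‖
        ≤ C * π * dist P Q * Real.exp (μ * u) := by
    intro P Q d hd u
    have hcont : ∀ P, Continuous fun v => N (d + u) (u + v) * E P v u := fun P =>
      (hN.comp (by fun_prop : Continuous fun v : ℝ => (d + u, u + v))).mul
        ((hE P).comp (by fun_prop : Continuous fun v : ℝ => (v, u)))
    rw [kernelSource, kernelSource, add_sub_add_left_eq_sub,
      ← intervalIntegral.integral_sub ((hcont P).intervalIntegrable _ _)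
        ((hcont Q).intervalIntegrable _ _)]
    have hb := intervalIntegral.norm_integral_le_of_norm_le_const (a := 0) (b := d)
      (f := fun v => N (d + u) (u + v) * E P v u - N (d + u) (u + v) * E Q v u)
      (C := C * (Real.exp (μ * u) * dist P Q)) (fun v _ => by
        rw [← mul_sub, norm_mul, ← mul_sub, norm_mul, Complex.norm_real,
          Real.norm_of_nonneg (Real.exp_pos _).le, ← dist_eq_norm]
        gcongr
        · exact hC _ _
        · exact ContinuousMap.dist_apply_le_dist _)
    refine hb.trans ?_
    rw [sub_zero, abs_of_nonneg hd.1]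
    calc _ ≤ C * (Real.exp (μ * u) * dist P Q) * π := by
            gcongr
            exact hd.2
      _ = _ := by ring
  have hT : ContractingWith (1 / 2) T := by
    refine ⟨by rw [← NNReal.coe_lt_coe]; norm_num, LipschitzWith.of_dist_le_mul fun P Q => ?_⟩
    refine (ContinuousMap.dist_le (by positivity)).2 fun p => ?_
    have hcont : ∀ P, Continuous fun u => kernelSource N (E P) p.1 u := fun P =>
      (continuous_kernelSource hN (hE P)).comp
        (by fun_prop : Continuous fun u : ℝ => ((p.1 : ℝ), u))
    have hb : ‖∫ u in (0:ℝ)..p.2, (kernelSource N (E P) p.1 u - kernelSource N (E Q) p.1 u)‖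
        ≤ ∫ u in (0:ℝ)..p.2, C * π * dist P Q * Real.exp (μ * u) :=
      intervalIntegral.norm_integral_le_of_norm_le p.2.2.1
        (.of_forall fun u _ => hdiff P Q _ p.1.2 u)
        (Continuous.intervalIntegrable (by fun_prop) _ _)
    rw [dist_eq_norm]
    change ‖(Real.exp (-(μ * p.2)) : ℂ) * (∫ u in (0:ℝ)..p.2, kernelSource N (E P) p.1 u)
      - (Real.exp (-(μ * p.2)) : ℂ) * (∫ u in (0:ℝ)..p.2, kernelSource N (E Q) p.1 u)‖ ≤ _
    rw [← mul_sub, ← intervalIntegral.integral_sub ((hcont P).intervalIntegrable _ _)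
      ((hcont Q).intervalIntegrable _ _), norm_mul, Complex.norm_real,
      Real.norm_of_nonneg (Real.exp_pos _).le]
    rw [intervalIntegral.integral_const_mul, intervalIntegral.integral_comp_mul_left _ hμ0.ne',
      integral_exp, mul_zero, Real.exp_zero, smul_eq_mul] at hb
    set y : ℝ := μ * p.2
    have hfrac : C * π * μ⁻¹ ≤ 1 / 2 := by
      rw [← div_eq_mul_inv, div_le_iff₀ hμ0]
      linarith
    calc _ ≤ Real.exp (-y) * (C * π * dist P Q * (μ⁻¹ * (Real.exp y - 1))) := by gcongr
      _ = C * π * μ⁻¹ * dist P Q * (1 - Real.exp (-y)) := by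
          have : Real.exp (-y) * Real.exp y = 1 := by rw [← Real.exp_add]; simp
          linear_combination (C * π * μ⁻¹ * dist P Q) * this
      _ ≤ 1 / 2 * dist P Q * 1 := by
          have h1 : (1 - Real.exp (-y)) ≤ 1 := by linarith [Real.exp_pos (-y)]
          have h2 : 0 ≤ C * π * μ⁻¹ * dist P Q := by positivity
          exact (mul_le_mul_of_nonneg_left h1 h2).trans (by gcongr)
      _ = _ := by simp
  have : Nonempty C(Icc 0 π × Icc 0 π, ℂ) := ⟨0⟩
  obtain ⟨P, hP⟩ : ∃ P, T P = P := ⟨_, hT.fixedPoint_isFixedPt⟩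
  refine ⟨E P, hE P, fun d hd t ht => ?_⟩
  have hval : T P (⟨d, hd⟩, ⟨t, ht⟩) = (Real.exp (-(μ * t)) : ℂ) *
      ∫ u in (0:ℝ)..t, kernelSource N (E P) d u := rfl
  have hEP : E P d t = (Real.exp (μ * t) : ℂ) * P (⟨d, hd⟩, ⟨t, ht⟩) := by
    simp only [E, pr, projIcc_of_mem _ hd, projIcc_of_mem _ ht]
  rw [hEP, ← hP, hval, ← mul_assoc, ← Complex.ofReal_mul, ← Real.exp_add, add_neg_cancel,
    Real.exp_zero, Complex.ofReal_one, one_mul, hP]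

/-- A continuous retraction of the plane onto `Triangle`. -/
noncomputable def triangleRetract (p : ℝ × ℝ) : ℝ × ℝ :=
  (max 0 (min p.1 π), max 0 (min p.2 (max 0 (min p.1 π))))

theorem continuous_triangleRetract : Continuous triangleRetract := by
  unfold triangleRetract
  fun_prop

theorem triangleRetract_mem (p : ℝ × ℝ) : triangleRetract p ∈ Triangle :=
  ⟨le_max_left _ _, max_le (le_max_left _ _) (min_le_right _ _),
    max_le pi_pos.le (min_le_right _ _)⟩

theorem triangleRetract_of_mem {p : ℝ × ℝ} (hp : p ∈ Triangle) : triangleRetract p = p := by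
  obtain ⟨h1, h2, h3⟩ := hp
  simp [triangleRetract, h1, h2, h3, h1.trans h2]

theorem isCompact_triangle : IsCompact Triangle := by
  have : Triangle = triangleRetract '' (Icc 0 π ×ˢ Icc 0 π) := by
    ext p
    refine ⟨fun hp => ⟨p, ?_, triangleRetract_of_mem hp⟩, ?_⟩
    · exact ⟨⟨hp.1.trans hp.2.1, hp.2.2⟩, hp.1, hp.2.1.trans hp.2.2⟩
    · rintro ⟨q, -, rfl⟩
      exact triangleRetract_mem q
  rw [this]
  exact (isCompact_Icc.prod isCompact_Icc).image continuous_triangleRetract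

/-- The kernel of the equation satisfied by `x ↦ ψ (π - x)` when `ψ` solves the adjoint equation
with kernel `M`, extended continuously to the plane. -/
noncomputable def reflectedKernel (M : ℝ → ℝ → ℂ) (x s : ℝ) : ℂ :=
  I * M (triangleRetract (π - s, π - x)).1 (triangleRetract (π - s, π - x)).2

theorem continuous_reflectedKernel {M : ℝ → ℝ → ℂ}
    (hM : ContinuousOn (fun p : ℝ × ℝ => M p.1 p.2) Triangle) :
    Continuous (reflectedKernel M).uncurry := by
  refine continuous_const.mul (hM.comp_continuous
    (f := fun p : ℝ × ℝ => triangleRetract (π - p.2, π - p.1)) ?_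
    fun _ => triangleRetract_mem _)
  exact continuous_triangleRetract.comp (by fun_prop)

theorem exists_norm_reflectedKernel_le {M : ℝ → ℝ → ℂ}
    (hM : ContinuousOn (fun p : ℝ × ℝ => M p.1 p.2) Triangle) :
    ∃ C, ∀ x s, ‖reflectedKernel M x s‖ ≤ C := by
  obtain ⟨C, hC⟩ := isCompact_triangle.exists_bound_of_continuousOn hM
  refine ⟨C, fun x s => ?_⟩
  simpa [reflectedKernel] using hC _ (triangleRetract_mem (π - s, π - x))

theorem integral_reflectedKernel (M : ℝ → ℝ → ℂ) (φ : ℝ → ℂ) {x : ℝ} (hx : x ∈ Icc 0 π) :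
    ∫ s in (0:ℝ)..(π - x), reflectedKernel M (π - x) s * φ (π - s)
      = I * ∫ t in x..π, M t x * φ t := by
  have h := intervalIntegral.integral_comp_sub_left (fun t => M t x * φ t) π
    (a := 0) (b := π - x)
  rw [sub_sub_cancel, sub_zero] at h
  rw [← h, ← intervalIntegral.integral_const_mul]
  refine intervalIntegral.integral_congr fun s hs => ?_
  rw [uIcc_of_le (by linarith [hx.2])] at hs
  have hmem : (π - s, x) ∈ Triangle := ⟨hx.1, by linarith [hs.2], by linarith [hs.1]⟩
  simp only [reflectedKernel, sub_sub_cancel, triangleRetract_of_mem hmem, mul_assoc]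

theorem hasDerivWithinAt_comp_pi_sub {f : ℝ → ℂ} {f' : ℂ} {x : ℝ}
    (h : HasDerivWithinAt f f' (Icc 0 π) (π - x)) :
    HasDerivWithinAt (fun y => f (π - y)) (-f') (Icc 0 π) x := by
  have hmaps : MapsTo (fun y : ℝ => π - y) (Icc 0 π) (Icc 0 π) :=
    fun y hy => ⟨by linarith [hy.2], by linarith [hy.1]⟩
  exact (h.scomp x ((hasDerivWithinAt_id x (Icc 0 π)).const_sub π) hmaps).congr_deriv (by simp)

theorem isVolterraSolution_of_adjoint {M : ℝ → ℝ → ℂ} {lam : ℂ} {φ φ' : ℝ → ℂ}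
    (h : ∀ x ∈ Icc 0 π, HasDerivWithinAt φ (φ' x) (Icc 0 π) x ∧
      -(I * φ' x) + (∫ t in x..π, M t x * φ t) = lam * φ x) :
    IsVolterraSolution (reflectedKernel M) (-I * lam) fun x => φ (π - x) := by
  intro x hx
  have hx' : π - x ∈ Icc 0 π := ⟨by linarith [hx.2], by linarith [hx.1]⟩
  obtain ⟨h1, h2⟩ := h _ hx'
  refine (hasDerivWithinAt_comp_pi_sub h1).congr_deriv ?_
  have h3 := integral_reflectedKernel M φ hx'
  rw [sub_sub_cancel] at h3
  rw [h3]
  linear_combination (-I) * h2 - φ' (π - x) * I_sq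

theorem IsVolterraSolution.adjoint {M : ℝ → ℝ → ℂ} {lam : ℂ} {w : ℝ → ℂ}
    (h : IsVolterraSolution (reflectedKernel M) (-I * lam) w) :
    ∃ φ' : ℝ → ℂ, ∀ x ∈ Icc 0 π,
      HasDerivWithinAt (fun x => w (π - x)) (φ' x) (Icc 0 π) x ∧
      -(I * φ' x) + (∫ t in x..π, M t x * w (π - t)) = lam * w (π - x) := by
  refine ⟨fun x => -(-I * lam * w (π - x)
    + ∫ s in (0:ℝ)..(π - x), reflectedKernel M (π - x) s * w s), fun x hx => ⟨?_, ?_⟩⟩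
  · exact hasDerivWithinAt_comp_pi_sub (h _ ⟨by linarith [hx.2], by linarith [hx.1]⟩)
  · have h3 := integral_reflectedKernel M (fun t => w (π - t)) hx
    simp only [sub_sub_cancel] at h3
    simp only [h3]
    linear_combination (-(lam * w (π - x)) + ∫ t in x..π, M t x * w (π - t)) * I_sq

/-- For every `λ` the adjoint equation (13) has a unique differentiable solution `ψ(·,λ)`
on `[0,π]` with `ψ(π,λ) = 1`; moreover there is a continuous kernel `K₁` on the triangle,
independent of `λ`, with `ψ(π−x,λ) = exp(−iλx) + ∫₀ˣ K₁(x,t) exp(−iλt) dt`. -/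
theorem stmt_16 (M : ℝ → ℝ → ℂ)
    (hM : ContinuousOn (fun p : ℝ × ℝ => M p.1 p.2) Triangle) :
    ∃ ψ : ℂ → ℝ → ℂ,
      (∀ lam : ℂ, ∃ ψ' : ℝ → ℂ,
        (∀ x ∈ Icc (0:ℝ) Real.pi,
          HasDerivWithinAt (ψ lam) (ψ' x) (Icc 0 Real.pi) x ∧
          -(Complex.I * ψ' x) + (∫ t in x..Real.pi, M t x * ψ lam t)
            = lam * ψ lam x) ∧
        ψ lam Real.pi = 1) ∧
      (∀ lam : ℂ, ∀ φ φ' : ℝ → ℂ,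
        (∀ x ∈ Icc (0:ℝ) Real.pi,
          HasDerivWithinAt φ (φ' x) (Icc 0 Real.pi) x ∧
          -(Complex.I * φ' x) + (∫ t in x..Real.pi, M t x * φ t) = lam * φ x) →
        φ Real.pi = 1 →
        ∀ x ∈ Icc (0:ℝ) Real.pi, φ x = ψ lam x) ∧
      (∃ K₁ : ℝ → ℝ → ℂ,
        ContinuousOn (fun p : ℝ × ℝ => K₁ p.1 p.2) Triangle ∧
        ∀ lam : ℂ, ∀ x ∈ Icc (0:ℝ) Real.pi,
          ψ lam (Real.pi - x) = Complex.exp (-Complex.I * lam * x)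
            + ∫ t in (0:ℝ)..x, K₁ x t * Complex.exp (-Complex.I * lam * t)) := by
  have hN := continuous_reflectedKernel hM
  obtain ⟨C, hC⟩ := exists_norm_reflectedKernel_le hM
  obtain ⟨L, hL, hLN⟩ := exists_volterraKernel hN hC
  let w : ℂ → ℝ → ℂ := fun lam x =>
    exp (-I * lam * x) + ∫ t in (0:ℝ)..x, L (x - t) t * exp (-I * lam * t)
  have hw : ∀ lam, IsVolterraSolution (reflectedKernel M) (-I * lam) (w lam) := fun lam =>
    isVolterraSolution_of_kernel hN hL hLN (-I * lam)
  have hw0 : ∀ lam, w lam 0 = 1 := fun lam => by simp [w]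
  refine ⟨fun lam x => w lam (π - x), fun lam => ?_, fun lam φ φ' hφ hφπ x hx => ?_,
    fun x t => L (x - t) t, ?_, fun lam x _ => ?_⟩
  · obtain ⟨ψ', hψ'⟩ := (hw lam).adjoint
    exact ⟨ψ', hψ', by simp [hw0]⟩
  · have h := ((isVolterraSolution_of_adjoint hφ).sub hN (hw lam)).eq_zero hC
      (by simp [hφπ, hw0]) (π - x) ⟨by linarith [hx.2], by linarith [hx.1]⟩
    simpa [sub_eq_zero] using h
  · exact (hL.comp
      (by fun_prop : Continuous fun p : ℝ × ℝ => (p.1 - p.2, p.2))).continuousOn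
  · simp only [sub_sub_cancel, w]
end
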